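/- arXiv:1705.04340 — 2 statements merged into one kernel-verified Lean document; each statement's English description precedes it below -/
import Mathlib

section
/- Let M and K be n×n real matrices with M invertible and t := ‖M⁻¹‖·‖K‖ < 1, and set B := I + M⁻¹K and A := M + K. Then B and A are invertible and κ(B)·(4 + ‖K‖·‖A⁻¹‖) ≤ 5 / (1 − t)². (Key intermediate estimate in the proof of the second bound of Theorem 3.1, using ‖B‖ ≤ 1 + t, ‖B⁻¹‖ ≤ 1/(1 − t), ‖K‖‖A⁻¹‖ ≤ t/(1 − t), and (1 + t)(4 − 3t) ≤ 5.) -/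
open Matrix

/-- Euclidean norm of a vector in `ℝⁿ`. -/
noncomputable def vnorm {n : ℕ} (v : Fin n → ℝ) : ℝ :=
  ‖(WithLp.equiv 2 (Fin n → ℝ)).symm v‖

/-- Operator norm (spectral norm) of a matrix, induced by the Euclidean norm. -/
noncomputable def opnorm {n : ℕ} (A : Matrix (Fin n) (Fin n) ℝ) : ℝ :=
  ‖Matrix.toEuclideanCLM (𝕜 := ℝ) A‖

/-- Condition number `κ(A) = ‖A‖·‖A⁻¹‖` with respect to the spectral norm. -/
noncomputable def condNum {n : ℕ} (A : Matrix (Fin n) (Fin n) ℝ) : ℝ :=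
  opnorm A * opnorm A⁻¹


theorem opnorm_nonneg {n : ℕ} (A : Matrix (Fin n) (Fin n) ℝ) : 0 ≤ opnorm A :=
  norm_nonneg _

theorem opnorm_mul_le {n : ℕ} (A B : Matrix (Fin n) (Fin n) ℝ) :
    opnorm (A * B) ≤ opnorm A * opnorm B := by
  unfold opnorm
  rw [map_mul]
  exact norm_mul_le _ _

theorem opnorm_add_le {n : ℕ} (A B : Matrix (Fin n) (Fin n) ℝ) :
    opnorm (A + B) ≤ opnorm A + opnorm B := by
  unfold opnorm
  rw [map_add]
  exact norm_add_le _ _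

theorem opnorm_neg {n : ℕ} (A : Matrix (Fin n) (Fin n) ℝ) : opnorm (-A) = opnorm A := by
  unfold opnorm
  rw [map_neg, norm_neg]

theorem opnorm_one_le {n : ℕ} : opnorm (1 : Matrix (Fin n) (Fin n) ℝ) ≤ 1 := by
  unfold opnorm
  rw [map_one]
  exact ContinuousLinearMap.norm_id_le

theorem isUnit_one_add_of_opnorm_lt_one {n : ℕ} {X : Matrix (Fin n) (Fin n) ℝ}
    (hX : opnorm X < 1) : IsUnit (1 + X) := by
  have h : IsUnit (Matrix.toEuclideanCLM (𝕜 := ℝ) (1 + X)) := by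
    rw [map_add, map_one, ← sub_neg_eq_add]
    exact isUnit_one_sub_of_norm_lt_one (by rwa [norm_neg])
  exact (MulEquiv.isUnit_map (Matrix.toEuclideanCLM (n := Fin n) (𝕜 := ℝ))).1 h

theorem opnorm_inv_one_add_le {n : ℕ} {X : Matrix (Fin n) (Fin n) ℝ} {t : ℝ}
    (hX : opnorm X ≤ t) (ht : t < 1) : opnorm (1 + X)⁻¹ ≤ 1 / (1 - t) := by
  have hdet := (Matrix.isUnit_iff_isUnit_det _).1
    (isUnit_one_add_of_opnorm_lt_one (hX.trans_lt ht))
  have heq : (1 + X)⁻¹ = 1 + -(X * (1 + X)⁻¹) := by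
    have h := Matrix.mul_nonsing_inv _ hdet
    rw [add_mul, one_mul] at h
    rw [← sub_eq_add_neg]
    exact eq_sub_of_add_eq h
  have h : opnorm (1 + X)⁻¹ ≤ 1 + t * opnorm (1 + X)⁻¹ :=
    calc opnorm (1 + X)⁻¹ = opnorm (1 + -(X * (1 + X)⁻¹)) := congrArg opnorm heq
      _ ≤ opnorm (1 : Matrix (Fin n) (Fin n) ℝ) + opnorm (X * (1 + X)⁻¹) := by
        simpa only [opnorm_neg] using opnorm_add_le 1 (-(X * (1 + X)⁻¹))
      _ ≤ 1 + t * opnorm (1 + X)⁻¹ :=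
        add_le_add opnorm_one_le ((opnorm_mul_le _ _).trans
          (mul_le_mul_of_nonneg_right hX (opnorm_nonneg _)))
  rw [le_div_iff₀ (by linarith)]
  linarith

theorem stmt9 {n : ℕ} (M K : Matrix (Fin n) (Fin n) ℝ) (hM : IsUnit M)
    (t : ℝ) (ht : t = opnorm M⁻¹ * opnorm K) (ht1 : t < 1)
    (B A : Matrix (Fin n) (Fin n) ℝ)
    (hBdef : B = 1 + M⁻¹ * K) (hAdef : A = M + K) :
    IsUnit B ∧ IsUnit A ∧
      condNum B * (4 + opnorm K * opnorm A⁻¹) ≤ 5 / (1 - t) ^ 2 := by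
  have hs : 0 < 1 - t := by linarith
  have ht0 : 0 ≤ t := ht ▸ mul_nonneg (opnorm_nonneg _) (opnorm_nonneg _)
  have hX : opnorm (M⁻¹ * K) ≤ t := ht ▸ opnorm_mul_le _ _
  have hB : IsUnit B := hBdef ▸ isUnit_one_add_of_opnorm_lt_one (hX.trans_lt ht1)
  have hAB : A = M * B := by
    rw [hAdef, hBdef, mul_add, mul_one,
      Matrix.mul_nonsing_inv_cancel_left _ _ ((Matrix.isUnit_iff_isUnit_det _).1 hM)]
  refine ⟨hB, hAB ▸ hM.mul hB, ?_⟩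
  have hBn : opnorm B ≤ 1 + t := by
    rw [hBdef]
    exact (opnorm_add_le _ _).trans (add_le_add opnorm_one_le hX)
  have hBi : opnorm B⁻¹ ≤ 1 / (1 - t) := hBdef ▸ opnorm_inv_one_add_le hX ht1
  have hKA : opnorm K * opnorm A⁻¹ ≤ t / (1 - t) :=
    calc opnorm K * opnorm A⁻¹ ≤ opnorm K * (opnorm B⁻¹ * opnorm M⁻¹) := by
          rw [hAB, Matrix.mul_inv_rev]
          exact mul_le_mul_of_nonneg_left (opnorm_mul_le _ _) (opnorm_nonneg _)
      _ = t * opnorm B⁻¹ := by rw [ht]; ring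
      _ ≤ t * (1 / (1 - t)) := mul_le_mul_of_nonneg_left hBi ht0
      _ = t / (1 - t) := by ring
  have hcond : condNum B ≤ (1 + t) * (1 / (1 - t)) :=
    mul_le_mul hBn hBi (opnorm_nonneg _) (by linarith)
  calc condNum B * (4 + opnorm K * opnorm A⁻¹)
      ≤ ((1 + t) * (1 / (1 - t))) * (4 + t / (1 - t)) :=
        mul_le_mul hcond (by linarith)
          (add_nonneg (by norm_num) (mul_nonneg (opnorm_nonneg _) (opnorm_nonneg _)))
          (by positivity)
    _ = (1 + t) * (4 - 3 * t) / (1 - t) ^ 2 := by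
        field_simp
        ring
    _ ≤ 5 / (1 - t) ^ 2 := by
        gcongr
        nlinarith [sq_nonneg (6 * t - 1)]
end

section
/- (Lemma 3.2, explicit constants.) Let M be an invertible n×n real matrix, K an n×n real matrix, v ∈ ℝⁿ, and 0 ≤ ε ≤ 1. Set B := I + M⁻¹K. Suppose e₁ ∈ ℝⁿ satisfies ‖e₁‖ ≤ ε·‖K‖·‖v‖ (error in computing Kv), ŵ ∈ ℝⁿ satisfies ‖ŵ − M⁻¹(Kv + e₁)‖ ≤ ε·‖M⁻¹‖·‖Kv + e₁‖ (inverse-equivalent application of M⁻¹), e₃ ∈ ℝⁿ satisfies ‖e₃‖ ≤ ε·(‖v‖ + ‖ŵ‖) (error in the final addition), and û := v + ŵ + e₃. Then ‖û − Bv‖ ≤ 7ε·(1 + ‖M⁻¹‖·‖K‖)·‖v‖. -/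
open Matrix

theorem vnorm_nonneg {n : ℕ} (x : Fin n → ℝ) : 0 ≤ vnorm x := norm_nonneg _

theorem vnorm_add_le {n : ℕ} (x y : Fin n → ℝ) : vnorm (x + y) ≤ vnorm x + vnorm y :=
  norm_add_le (WithLp.toLp 2 x) (WithLp.toLp 2 y)

theorem vnorm_mulVec_le {n : ℕ} (A : Matrix (Fin n) (Fin n) ℝ) (x : Fin n → ℝ) :
    vnorm (A.mulVec x) ≤ opnorm A * vnorm x :=
  (Matrix.toEuclideanCLM (𝕜 := ℝ) A).le_opNorm (WithLp.toLp 2 x)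

theorem stmt12 {n : ℕ} (M K : Matrix (Fin n) (Fin n) ℝ) (hM : IsUnit M)
    (v : Fin n → ℝ) (ε : ℝ) (hε0 : 0 ≤ ε) (hε1 : ε ≤ 1)
    (B : Matrix (Fin n) (Fin n) ℝ) (hBdef : B = 1 + M⁻¹ * K)
    (e₁ : Fin n → ℝ) (he₁ : vnorm e₁ ≤ ε * opnorm K * vnorm v)
    (what : Fin n → ℝ)
    (hw : vnorm (what - M⁻¹.mulVec (K.mulVec v + e₁)) ≤
      ε * opnorm M⁻¹ * vnorm (K.mulVec v + e₁))
    (e₃ : Fin n → ℝ) (he₃ : vnorm e₃ ≤ ε * (vnorm v + vnorm what))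
    (uhat : Fin n → ℝ) (hu : uhat = v + what + e₃) :
    vnorm (uhat - B.mulVec v) ≤ 7 * ε * (1 + opnorm M⁻¹ * opnorm K) * vnorm v := by
  subst hBdef hu
  set y := K.mulVec v + e₁ with hy
  set d := what - M⁻¹.mulVec y with hd
  have hv := vnorm_nonneg v
  have ha := opnorm_nonneg M⁻¹
  have hk := opnorm_nonneg K
  have hkv : 0 ≤ opnorm K * vnorm v := by positivity
  have hakv : 0 ≤ opnorm M⁻¹ * (opnorm K * vnorm v) := by positivity
  have hy_le : vnorm y ≤ 2 * (opnorm K * vnorm v) := by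
    have h₁ := vnorm_add_le (K.mulVec v) e₁
    have h₂ := vnorm_mulVec_le K v
    have h₃ := mul_le_mul_of_nonneg_right hε1 hkv
    linarith
  have hay : opnorm M⁻¹ * vnorm y ≤ 2 * (opnorm M⁻¹ * (opnorm K * vnorm v)) := by
    have := mul_le_mul_of_nonneg_left hy_le ha
    linarith
  have hd_le : vnorm d ≤ ε * (2 * (opnorm M⁻¹ * (opnorm K * vnorm v))) := by
    have := mul_le_mul_of_nonneg_left hay hε0
    linarith
  have hwhat : vnorm what ≤ 4 * (opnorm M⁻¹ * (opnorm K * vnorm v)) := by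
    have h₁ := vnorm_add_le (M⁻¹.mulVec y) d
    rw [hd, add_sub_cancel, ← hd] at h₁
    have h₂ := vnorm_mulVec_le M⁻¹ y
    have h₃ := mul_le_mul_of_nonneg_right hε1 hakv
    linarith
  have he₃_le : vnorm e₃ ≤ ε * (vnorm v + 4 * (opnorm M⁻¹ * (opnorm K * vnorm v))) :=
    he₃.trans (by gcongr)
  have hMe₁ : vnorm (M⁻¹.mulVec e₁) ≤ ε * (opnorm M⁻¹ * (opnorm K * vnorm v)) := by
    have h₁ := vnorm_mulVec_le M⁻¹ e₁
    have h₂ := mul_le_mul_of_nonneg_left he₁ ha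
    linarith
  have hsplit : v + what + e₃ - (1 + M⁻¹ * K).mulVec v = M⁻¹.mulVec e₁ + d + e₃ := by
    rw [hd, hy, Matrix.add_mulVec, Matrix.one_mulVec, Matrix.mulVec_add, Matrix.mulVec_mulVec]
    abel
  rw [hsplit]
  have h₁ := vnorm_add_le (M⁻¹.mulVec e₁ + d) e₃
  have h₂ := vnorm_add_le (M⁻¹.mulVec e₁) d
  have h₃ : 0 ≤ ε * vnorm v := by positivity
  linarith
end
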